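/- Fix A ∈ [0, 1/2) and define θ(t) = √( t(2−t)(1−2A) )/2 and Ĩ(t) = h₂(t/2) − ( h₂(t/2 − θ(t)) + h₂(t/2 + θ(t)) )/2 for t ∈ [ (1−2A)/(1−A), 1 ], where h₂ is the binary entropy function. Then Ĩ is nonincreasing on the interval [ (1−2A)/(1−A), 1 ]; consequently its minimum over this interval is attained at t = 1, and Ĩ(1) = 1 − h₂( (1 − √(1−2A))/2 ). -/

import Mathlib

/-- Binary entropy function with base-2 logarithm (with `h₂ 0 = h₂ 1 = 0` by the
Lean convention `logb 2 0 = 0`). -/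
noncomputable def binEnt (x : ℝ) : ℝ :=
  -(x * Real.logb 2 x) - (1 - x) * Real.logb 2 (1 - x)

/-- Mutual information `I(w,z)` of the binary test channel `[[w,1−w],[z,1−z]]`
with uniform input. -/
noncomputable def mutI (w z : ℝ) : ℝ :=
  binEnt ((w + z) / 2) - (binEnt w + binEnt z) / 2

/-- Expected total-variation semantic distortion `Λ(w,z)` (fractions with zero
denominator are `0` by the Lean convention `a / 0 = 0`). -/
noncomputable def lamTV (C w z : ℝ) : ℝ :=
  C * (w * z / (w + z) + (1 - w) * (1 - z) / (2 - w - z))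

/-- Expected Hamming distortion `Γ(w,z)`. -/
noncomputable def gamH (w z : ℝ) : ℝ := (1 + z - w) / 2

/-- The threshold `a(D_o)`. -/
noncomputable def aThresh (C Do_ : ℝ) : ℝ :=
  if Do_ ≤ 1 / 2 then 2 * C * Do_ * (1 - Do_) else C / 2

/-- The semantic rate distortion function `R(D_p, D_o)` for the binary case. -/
noncomputable def Rbin (C Dp Do_ : ℝ) : ℝ :=
  sInf {r : ℝ | ∃ w z : ℝ, w ∈ Set.Icc (0 : ℝ) 1 ∧ z ∈ Set.Icc (0 : ℝ) 1 ∧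
    lamTV C w z ≤ Dp ∧ gamH w z ≤ Do_ ∧ r = mutI w z}

/-- The parameterization `θ(t) = √(t(2−t)(1−2A))/2`. -/
noncomputable def thetaA (A t : ℝ) : ℝ := Real.sqrt (t * (2 - t) * (1 - 2 * A)) / 2

/-- `Ĩ(t) = h₂(t/2) − (h₂(t/2−θ(t)) + h₂(t/2+θ(t)))/2`. -/
noncomputable def Itil (A t : ℝ) : ℝ :=
  binEnt (t / 2) - (binEnt (t / 2 - thetaA A t) + binEnt (t / 2 + thetaA A t)) / 2

open Set

/-- `(1 + √y) log (1 + √y) + (1 - √y) log (1 - √y)`, a convex function of `y ∈ [0, 1]`. -/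
noncomputable def sqrtEntropyGap (y : ℝ) : ℝ :=
  (1 + √y) * Real.log (1 + √y) + (1 - √y) * Real.log (1 - √y)

lemma hasDerivAt_sqrtEntropyGap {y : ℝ} (hy : y ∈ Ioo (0 : ℝ) 1) :
    HasDerivAt sqrtEntropyGap ((Real.log (1 + √y) - Real.log (1 - √y)) / (2 * √y)) y := by
  have hpos : 0 < √y := Real.sqrt_pos.2 hy.1
  have hlt : √y < 1 := by rw [Real.sqrt_lt' one_pos]; simpa using hy.2
  have hs : HasDerivAt Real.sqrt (1 / (2 * √y)) y := Real.hasDerivAt_sqrt hy.1.ne'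
  have h₁ := (Real.hasDerivAt_mul_log (by positivity : 1 + √y ≠ 0)).comp y (hs.const_add 1)
  have h₂ := (Real.hasDerivAt_mul_log (by linarith : 1 - √y ≠ 0)).comp y (hs.const_sub 1)
  refine (h₁.add h₂).congr_deriv ?_
  field_simp
  ring

lemma log_one_add_sub_log_one_sub_div_le {s t : ℝ} (hs : 0 < s) (hst : s ≤ t) (ht : t < 1) :
    (Real.log (1 + s) - Real.log (1 - s)) / (2 * s) ≤
      (Real.log (1 + t) - Real.log (1 - t)) / (2 * t) := by
  have ht₀ : 0 < t := hs.trans_le hst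
  have hsum : ∀ x : ℝ, 0 < x → x < 1 → HasSum (fun k : ℕ => x ^ (2 * k) / (2 * k + 1))
      ((Real.log (1 + x) - Real.log (1 - x)) / (2 * x)) := by
    intro x hx hx₁
    refine ((Real.hasSum_log_sub_log_of_abs_lt_one (by rwa [abs_of_pos hx])).div_const
      (2 * x)).congr_fun ?_
    intro k
    have : (2 * k + 1 : ℝ) ≠ 0 := by positivity
    field_simp
    ring
  refine hasSum_le (fun k => ?_) (hsum s hs (hst.trans_lt ht)) (hsum t ht₀ ht)
  gcongr

lemma convexOn_sqrtEntropyGap : ConvexOn ℝ (Icc 0 1) sqrtEntropyGap := by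
  refine MonotoneOn.convexOn_of_deriv (convex_Icc 0 1) ?_ ?_ ?_
  · have h₁ : Continuous fun y : ℝ => (1 + √y) * Real.log (1 + √y) :=
      Real.continuous_mul_log.comp (by fun_prop : Continuous fun y : ℝ => 1 + √y)
    have h₂ : Continuous fun y : ℝ => (1 - √y) * Real.log (1 - √y) :=
      Real.continuous_mul_log.comp (by fun_prop : Continuous fun y : ℝ => 1 - √y)
    exact (h₁.add h₂).continuousOn
  · rw [interior_Icc]
    exact fun y hy => (hasDerivAt_sqrtEntropyGap hy).differentiableAt.differentiableWithinAt
  · rw [interior_Icc]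
    intro x hx y hy hxy
    rw [(hasDerivAt_sqrtEntropyGap hx).deriv, (hasDerivAt_sqrtEntropyGap hy).deriv]
    refine log_one_add_sub_log_one_sub_div_le (Real.sqrt_pos.2 hx.1) (Real.sqrt_le_sqrt hxy) ?_
    rw [Real.sqrt_lt' one_pos]
    simpa using hy.2

lemma ConvexOn.perspective_le {S : Set ℝ} {f : ℝ → ℝ} (hf : ConvexOn ℝ S f) {a b c x y z : ℝ}
    (hx : x ∈ S) (hy : y ∈ S) (ha : 0 ≤ a) (hb : 0 ≤ b) (hc : 0 < c) (hab : a + b = c)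
    (hz : c * z = a * x + b * y) : c * f z ≤ a * f x + b * f y := by
  have h := hf.2 hx hy (div_nonneg ha hc.le) (div_nonneg hb hc.le)
    (by rw [← add_div, hab, div_self hc.ne'])
  simp only [smul_eq_mul] at h
  have hz' : a / c * x + b / c * y = z := by field_simp; linarith
  rw [hz'] at h
  calc c * f z ≤ c * (a / c * f x + b / c * f y) := by gcongr
    _ = a * f x + b * f y := by field_simp

/-- The symmetrized perspective of a convex function decreases towards the midpoint. -/
lemma ConvexOn.symm_perspective_le {f : ℝ → ℝ} (hf : ConvexOn ℝ (Icc 0 1) f) {k p p' : ℝ}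
    (hk : 0 ≤ k) (hk₁ : k ≤ 1) (hp : 0 < p) (hkp : k * (1 - p) ≤ p) (hpp' : p ≤ p')
    (hp' : p' ≤ 1 / 2) :
    p' * f (k * (1 - p') / p') + (1 - p') * f (k * p' / (1 - p')) ≤
      p * f (k * (1 - p) / p) + (1 - p) * f (k * p / (1 - p)) := by
  rcases hpp'.eq_or_lt with rfl | hlt
  · exact le_rfl
  have hq : 0 < 1 - p := by linarith
  have hp'₀ : 0 < p' := hp.trans hlt
  have hq' : 0 < 1 - p' := by linarith
  have hd : 0 < 1 - p - p := by linarith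
  obtain ⟨u, v, hu, hv, huv, hcomb⟩ : ∃ u v : ℝ, 0 ≤ u ∧ 0 ≤ v ∧ u + v = 1 ∧
      u * p + v * (1 - p) = p' := by
    refine ⟨(1 - p - p') / (1 - p - p), (p' - p) / (1 - p - p), div_nonneg (by linarith) hd.le,
      div_nonneg (by linarith) hd.le, ?_, ?_⟩
    · field_simp
      ring
    · field_simp
      ring
  have hx : k * (1 - p) / p ∈ Icc (0 : ℝ) 1 := ⟨by positivity, (div_le_one hp).2 hkp⟩
  have hy : k * p / (1 - p) ∈ Icc (0 : ℝ) 1 :=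
    ⟨by positivity, (div_le_one hq).2 (by nlinarith)⟩
  have hcomb' : v * p + u * (1 - p) = 1 - p' := by linear_combination huv - hcomb
  have h₁ := hf.perspective_le (z := k * (1 - p') / p') hx hy (mul_nonneg hu hp.le)
    (mul_nonneg hv hq.le) hp'₀ hcomb (by
      field_simp
      linear_combination -k * hcomb')
  have h₂ := hf.perspective_le (z := k * p' / (1 - p')) hx hy (mul_nonneg hv hp.le)
    (mul_nonneg hu hq.le) hq' hcomb' (by
      field_simp
      linear_combination -k * hcomb)
  calc _ ≤ _ := add_le_add h₁ h₂
    _ = (u + v) * (p * f (k * (1 - p) / p) + (1 - p) * f (k * p / (1 - p))) := by ring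
    _ = _ := by rw [huv, one_mul]

lemma mul_sqrtEntropyGap {p s y : ℝ} (hp : 0 < p) (hy : √y = s / p) :
    p * sqrtEntropyGap y =
      (p + s) * Real.log (p + s) + (p - s) * Real.log (p - s) - 2 * p * Real.log p := by
  have key : ∀ z : ℝ, z * Real.log (z / p) = z * Real.log z - z * Real.log p := by
    intro z
    rcases eq_or_ne z 0 with rfl | hz
    · simp
    · rw [Real.log_div hz hp.ne']
      ring
  have h₁ : 1 + s / p = (p + s) / p := by field_simp
  have h₂ : 1 - s / p = (p - s) / p := by field_simp
  calc p * sqrtEntropyGap y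
      = (p + s) * Real.log ((p + s) / p) + (p - s) * Real.log ((p - s) / p) := by
        rw [sqrtEntropyGap, hy, h₁, h₂]
        field_simp
    _ = _ := by
        rw [key, key]
        ring

lemma thetaA_div (A : ℝ) {t p : ℝ} (hp : 0 < p) :
    √(t * (2 - t) * (1 - 2 * A) / (2 * p) ^ 2) = thetaA A t / p := by
  rw [Real.sqrt_div' _ (by positivity), Real.sqrt_sq (by positivity), thetaA]
  field_simp

lemma Itil_eq_sqrtEntropyGap (A : ℝ) {t : ℝ} (ht : 0 < t) (ht₁ : t ≤ 1) :
    Itil A t = (t / 2 * sqrtEntropyGap ((1 - 2 * A) * (1 - t / 2) / (t / 2)) +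
      (1 - t / 2) * sqrtEntropyGap ((1 - 2 * A) * (t / 2) / (1 - t / 2))) /
        (2 * Real.log 2) := by
  have hp : 0 < t / 2 := by linarith
  have hq : 0 < 1 - t / 2 := by linarith
  have hlog : Real.log 2 ≠ 0 := (Real.log_pos one_lt_two).ne'
  have h₁ : √((1 - 2 * A) * (1 - t / 2) / (t / 2)) = thetaA A t / (t / 2) := by
    rw [← thetaA_div A hp]
    congr 1
    field_simp
  have h₂ : √((1 - 2 * A) * (t / 2) / (1 - t / 2)) = thetaA A t / (1 - t / 2) := by
    rw [← thetaA_div A hq]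
    congr 1
    have : 2 - t ≠ 0 := by linarith
    field_simp
  rw [mul_sqrtEntropyGap hp h₁, mul_sqrtEntropyGap hq h₂]
  have e₁ : 1 - (t / 2 - thetaA A t) = 1 - t / 2 + thetaA A t := by ring
  have e₂ : 1 - (t / 2 + thetaA A t) = 1 - t / 2 - thetaA A t := by ring
  simp only [Itil, binEnt, Real.logb, e₁, e₂]
  field_simp
  ring

lemma binEnt_one_sub (x : ℝ) : binEnt (1 - x) = binEnt x := by
  simp only [binEnt, sub_sub_cancel]
  ring

lemma binEnt_half : binEnt (1 / 2) = 1 := by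
  have h : (1 : ℝ) - 1 / 2 = 1 / 2 := by norm_num
  rw [binEnt, h, one_div, Real.logb_inv, Real.logb_self_eq_one one_lt_two]
  norm_num

/-- `Ĩ` is nonincreasing on `[(1−2A)/(1−A), 1]`; its minimum over this interval
is attained at `t = 1`, and `Ĩ(1) = 1 − h₂((1−√(1−2A))/2)`. -/
theorem Itil_nonincreasing
    (A : ℝ) (hA : A ∈ Set.Ico (0 : ℝ) (1 / 2)) :
    (∀ t₁ ∈ Set.Icc ((1 - 2 * A) / (1 - A)) 1,
      ∀ t₂ ∈ Set.Icc ((1 - 2 * A) / (1 - A)) 1, t₁ ≤ t₂ → Itil A t₂ ≤ Itil A t₁) ∧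
    (∀ t ∈ Set.Icc ((1 - 2 * A) / (1 - A)) 1, Itil A 1 ≤ Itil A t) ∧
    Itil A 1 = 1 - binEnt ((1 - Real.sqrt (1 - 2 * A)) / 2) := by
  have hA₁ : 0 < 1 - A := by linarith [hA.2]
  have hk : 0 < 1 - 2 * A := by linarith [hA.2]
  have anti : ∀ t₁ ∈ Set.Icc ((1 - 2 * A) / (1 - A)) 1,
      ∀ t₂ ∈ Set.Icc ((1 - 2 * A) / (1 - A)) 1, t₁ ≤ t₂ → Itil A t₂ ≤ Itil A t₁ := by
    intro t₁ ht₁ t₂ ht₂ hle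
    have hpos : 0 < t₁ := (div_pos hk hA₁).trans_le ht₁.1
    have hlow := (div_le_iff₀ hA₁).1 ht₁.1
    rw [Itil_eq_sqrtEntropyGap A hpos ht₁.2, Itil_eq_sqrtEntropyGap A (hpos.trans_le hle) ht₂.2]
    exact div_le_div_of_nonneg_right
      (convexOn_sqrtEntropyGap.symm_perspective_le hk.le (by linarith [hA.1]) (by linarith)
        (by linarith) (by linarith) (by linarith [ht₂.2])) (by positivity)
  have hmem : (1 : ℝ) ∈ Set.Icc ((1 - 2 * A) / (1 - A)) 1 :=
    ⟨(div_le_one hA₁).2 (by linarith [hA.1]), le_rfl⟩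
  refine ⟨anti, fun t ht => anti t ht 1 hmem ht.2, ?_⟩
  have hθ : thetaA A 1 = √(1 - 2 * A) / 2 := by
    rw [thetaA]
    norm_num
  have h₁ : 1 / 2 - √(1 - 2 * A) / 2 = (1 - √(1 - 2 * A)) / 2 := by ring
  have h₂ : 1 / 2 + √(1 - 2 * A) / 2 = 1 - (1 - √(1 - 2 * A)) / 2 := by ring
  rw [Itil, hθ, h₁, h₂, binEnt_one_sub, binEnt_half]
  ring
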